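/- arXiv:1704.00134 — 8 statements merged into one kernel-verified Lean document; each statement's English description precedes it below -/
import Mathlib

section
/- Let g, h, A be real symmetric positive definite d×d matrices that pairwise commute, and let m₀, τ_κ > 0. Then for every λ ∈ ℂ with Re(λ) > 0, the complex matrix λτ_κ I + A is invertible, and the complex matrix B_λ := I + g (λτ_κ I + A)⁻¹ A h/(λ m₀) is invertible. -/
open Matrix

open scoped MatrixOrder ComplexOrder

variable {n : Type*} [Fintype n] [DecidableEq n]

namespace Matrix.PosSemidef

/-- A real positive semidefinite matrix stays positive semidefinite over the complex numbers. -/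
theorem map_ofReal {P : Matrix n n ℝ} (hP : P.PosSemidef) :
    (P.map Complex.ofReal).PosSemidef := by
  obtain ⟨C, rfl⟩ := CStarAlgebra.nonneg_iff_eq_star_mul_self.mp hP.nonneg
  have hC : (star C * C).map Complex.ofReal =
      (C.map Complex.ofReal)ᴴ * C.map Complex.ofReal := by
    ext i j
    simp [Matrix.mul_apply, star_eq_conjTranspose]
  rw [hC]
  exact posSemidef_conjTranspose_mul_self _

/-- The product of two commuting positive semidefinite matrices is positive semidefinite. -/
theorem mul_of_commute {𝕜 : Type*} [RCLike 𝕜] {P Q : Matrix n n 𝕜}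
    (hP : P.PosSemidef) (hQ : Q.PosSemidef) (h : Commute P Q) : (P * Q).PosSemidef :=
  (h.mul_nonneg hP.nonneg hQ.nonneg).posSemidef

/-- If `Q` and `P` are positive semidefinite, `0 < a` and `0 < re z`, then
`(z * a) • 1 + Q + z⁻¹ • P` has positive definite real part, hence is invertible. -/
theorem isUnit_smul_one_add_add_inv_smul {Q P : Matrix n n ℂ}
    (hQ : Q.PosSemidef) (hP : P.PosSemidef) {a : ℝ} (ha : 0 < a) {z : ℂ} (hz : 0 < z.re) :
    IsUnit ((z * a) • (1 : Matrix n n ℂ) + Q + z⁻¹ • P) := by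
  rw [isUnit_iff_isUnit_det, isUnit_iff_ne_zero]
  intro hdet
  obtain ⟨v, hv, hv0⟩ := exists_mulVec_eq_zero_iff.mpr hdet
  have hform : z * a * (star v ⬝ᵥ v) + star v ⬝ᵥ Q *ᵥ v + z⁻¹ * (star v ⬝ᵥ P *ᵥ v) = 0 := by
    simpa [add_mulVec, smul_mulVec, dotProduct_add] using congrArg (star v ⬝ᵥ ·) hv0
  obtain ⟨hs, hs'⟩ := Complex.pos_iff.mp (dotProduct_star_self_pos_iff.mpr hv)
  obtain ⟨hq, -⟩ := Complex.nonneg_iff.mp (hQ.dotProduct_mulVec_nonneg v)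
  obtain ⟨hp, hp'⟩ := Complex.nonneg_iff.mp (hP.dotProduct_mulVec_nonneg v)
  have hre := congrArg Complex.re hform
  simp only [Complex.add_re, Complex.mul_re, Complex.mul_im, Complex.ofReal_re, Complex.ofReal_im,
    ← hs', ← hp', Complex.inv_re, Complex.zero_re, mul_zero, sub_zero] at hre
  have hnorm : 0 ≤ z.re / Complex.normSq z := div_nonneg hz.le (Complex.normSq_nonneg z)
  have := mul_pos (mul_pos hz ha) hs
  have := mul_nonneg hnorm hp
  linarith

end Matrix.PosSemidef

/-- If `g`, `h`, `A` are commuting real symmetric positive definite `d × d`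
matrices and `m₀, τκ > 0`, then for each complex `λ` with `Re λ > 0` the matrices
`λτκ I + A` and `B_λ = I + g (λτκ I + A)⁻¹ A h/(λ m₀)` (regarded over ℂ) are invertible. -/
theorem Blam_invertible_of_commuting_posDef
    (d : ℕ) (g h A : Matrix (Fin d) (Fin d) ℝ)
    (hg : g.PosDef) (hh : h.PosDef) (hA : A.PosDef)
    (hgh : g * h = h * g) (hgA : g * A = A * g) (hhA : h * A = A * h)
    (m₀ τκ : ℝ) (hm₀ : 0 < m₀) (hτκ : 0 < τκ) :
    ∀ lam : ℂ, 0 < lam.re →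
      IsUnit ((lam * (τκ : ℂ)) • (1 : Matrix (Fin d) (Fin d) ℂ) + A.map (Complex.ofReal)) ∧
      IsUnit
        ((1 : Matrix (Fin d) (Fin d) ℂ) +
          (lam * (m₀ : ℂ))⁻¹ •
            (g.map (Complex.ofReal) *
              ((lam * (τκ : ℂ)) • (1 : Matrix (Fin d) (Fin d) ℂ) + A.map (Complex.ofReal))⁻¹ *
              A.map (Complex.ofReal) * h.map (Complex.ofReal))) := by
  intro lam hlam
  have hM : IsUnit ((lam * (τκ : ℂ)) • (1 : Matrix (Fin d) (Fin d) ℂ) +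
      A.map Complex.ofReal) := by
    simpa using hA.posSemidef.map_ofReal.isUnit_smul_one_add_add_inv_smul .zero hτκ hlam
  refine ⟨hM, ?_⟩
  have hP : (m₀⁻¹ • (g * A * h)).PosSemidef :=
    ((hg.posSemidef.mul_of_commute hA.posSemidef hgA).mul_of_commute hh.posSemidef
      (Commute.mul_left hgh hhA.symm)).smul (inv_nonneg.mpr hm₀.le)
  have hN := hA.posSemidef.map_ofReal.isUnit_smul_one_add_add_inv_smul hP.map_ofReal hτκ hlam
  have hPmap : (m₀⁻¹ • (g * A * h)).map Complex.ofReal = (m₀ : ℂ)⁻¹ •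
      (g.map Complex.ofReal * A.map Complex.ofReal * h.map Complex.ofReal) := by
    ext i j
    simp [Matrix.mul_apply]
  have hgA' : Commute (g.map Complex.ofReal) (A.map Complex.ofReal) :=
    Commute.map hgA (Complex.ofRealHom.mapMatrix (m := Fin d))
  rw [hPmap] at hN
  set M := (lam * (τκ : ℂ)) • (1 : Matrix (Fin d) (Fin d) ℂ) + A.map Complex.ofReal
  have hgM : Commute M (g.map Complex.ofReal) :=
    ((Commute.one_left _).smul_left _).add_left hgA'.symm
  refine hM.mul_left_iff.mp ?_
  convert hN using 1
  rw [mul_add, mul_one, mul_smul_comm, smul_smul, mul_inv, ← mul_assoc, ← mul_assoc, ← mul_assoc,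
    hgM.eq, mul_assoc _ M M⁻¹, mul_nonsing_inv _ ((isUnit_iff_isUnit_det M).mp hM), mul_one]
end

section
/- Let m₀, τ_κ, τ_η, α > 0 and let g, σ be real numbers with g ≠ 0. The real 3×3 matrix γ := [[0, g/m₀, −σ/m₀], [−αg/τ_κ, α/τ_κ, 0], [0, 0, α/τ_η]] has characteristic polynomial (λ − α/τ_η)·(λ² − (α/τ_κ)λ + αg²/(m₀τ_κ)); its eigenvalues over ℂ are α/τ_η and α/(2τ_κ) ± (1/2)·√((α²m₀ − 4αg²τ_κ)/(m₀τ_κ²)) (with the complex square root when the radicand is negative), and every eigenvalue has positive real part, i.e. γ is positive stable. -/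
open Matrix Polynomial

/-- The quadratic formula over a field of characteristic not two, for a monic quadratic. -/
theorem monic_quadratic_eq_zero_iff {K : Type*} [Field K] [NeZero (2 : K)] {b c s : K}
    (hs : s ^ 2 = b ^ 2 - 4 * c) (z : K) :
    z ^ 2 - b * z + c = 0 ↔ z = b / 2 + 1 / 2 * s ∨ z = b / 2 - 1 / 2 * s := by
  have h2 : (2 : K) ≠ 0 := two_ne_zero
  have hfactor : z ^ 2 - b * z + c = (z - (b / 2 + 1 / 2 * s)) * (z - (b / 2 - 1 / 2 * s)) := by
    field_simp
    linear_combination hs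
  rw [hfactor, mul_eq_zero, sub_eq_zero, sub_eq_zero]

/-- The complex roots of `z² - bz + c` with `b, c > 0` lie in the open right half-plane. -/
theorem re_pos_of_monic_quadratic_eq_zero {b c : ℝ} (hb : 0 < b) (hc : 0 < c) {z : ℂ}
    (hz : z ^ 2 - b * z + c = 0) : 0 < z.re := by
  have hre := congrArg Complex.re hz
  have him := congrArg Complex.im hz
  simp [pow_two] at hre him
  rcases eq_or_ne z.im 0 with h | h
  · rw [h] at hre
    by_contra! hneg
    nlinarith [mul_nonneg hb.le (neg_nonneg.mpr hneg), mul_self_nonneg z.re]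
  · have : 2 * z.re = b := mul_right_cancel₀ h (by linarith)
    linarith

/-- The 3×3 drift matrix `γ` of the one-dimensional Ornstein–Uhlenbeck model has
characteristic polynomial `(λ − α/τη)(λ² − (α/τκ)λ + αg²/(m₀τκ))`, eigenvalues
`α/τη` and `α/(2τκ) ± (1/2)√((α²m₀ − 4αg²τκ)/(m₀τκ²))` (complex square root), and is
positive stable. -/
theorem gamma_charpoly_spectrum_posStable
    (m₀ τκ τη α : ℝ) (hm₀ : 0 < m₀) (hτκ : 0 < τκ) (hτη : 0 < τη) (hα : 0 < α)
    (g σ : ℝ) (hg : g ≠ 0) :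
    let γ : Matrix (Fin 3) (Fin 3) ℝ :=
      !![0, g / m₀, -σ / m₀; -α * g / τκ, α / τκ, 0; 0, 0, α / τη]
    let s : ℂ := (((α ^ 2 * m₀ - 4 * α * g ^ 2 * τκ) / (m₀ * τκ ^ 2) : ℝ) : ℂ) ^ ((1 : ℂ) / 2)
    γ.charpoly =
        (X - Polynomial.C (α / τη)) *
          (X ^ 2 - Polynomial.C (α / τκ) * X + Polynomial.C (α * g ^ 2 / (m₀ * τκ))) ∧
      spectrum ℂ (γ.map (Complex.ofReal)) =
        {((α / τη : ℝ) : ℂ), ((α / (2 * τκ) : ℝ) : ℂ) + (1 / 2 : ℂ) * s,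
          ((α / (2 * τκ) : ℝ) : ℂ) - (1 / 2 : ℂ) * s} ∧
      ∀ μ ∈ spectrum ℂ (γ.map (Complex.ofReal)), 0 < μ.re := by
  intro γ s
  have hcharpoly : γ.charpoly = (X - Polynomial.C (α / τη)) *
      (X ^ 2 - Polynomial.C (α / τκ) * X + Polynomial.C (α * g ^ 2 / (m₀ * τκ))) := by
    have hconst : α * g ^ 2 / (m₀ * τκ) = -(g / m₀ * (-α * g / τκ)) := by
      field_simp
    rw [hconst, Matrix.charpoly, Matrix.det_fin_three]
    simp [γ]
    ring
  have hmem (μ : ℂ) : μ ∈ spectrum ℂ (γ.map Complex.ofReal) ↔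
      μ = ((α / τη : ℝ) : ℂ) ∨
        μ ^ 2 - ((α / τκ : ℝ) : ℂ) * μ + ((α * g ^ 2 / (m₀ * τκ) : ℝ) : ℂ) = 0 := by
    have hmap : (γ.map Complex.ofReal).charpoly = γ.charpoly.map Complex.ofRealHom :=
      Matrix.charpoly_map γ Complex.ofRealHom
    rw [Matrix.mem_spectrum_iff_isRoot_charpoly, hmap, hcharpoly]
    simp [Polynomial.IsRoot, sub_eq_zero]
  have hs : s ^ 2 = ((α / τκ : ℝ) : ℂ) ^ 2 - 4 * ((α * g ^ 2 / (m₀ * τκ) : ℝ) : ℂ) := by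
    have hsq : s ^ 2 = (((α ^ 2 * m₀ - 4 * α * g ^ 2 * τκ) / (m₀ * τκ ^ 2) : ℝ) : ℂ) := by
      simp only [s, one_div]
      exact Complex.cpow_nat_inv_pow _ two_ne_zero
    rw [hsq]
    norm_cast
    field_simp
  refine ⟨hcharpoly, ?_, fun μ hμ => ?_⟩
  · ext μ
    have hhalf : ((α / (2 * τκ) : ℝ) : ℂ) = ((α / τκ : ℝ) : ℂ) / 2 := by
      push_cast
      ring
    rw [hmem, monic_quadratic_eq_zero_iff hs, hhalf]
    rfl
  · rcases (hmem μ).mp hμ with rfl | hroot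
    · rw [Complex.ofReal_re]
      positivity
    · exact re_pos_of_monic_quadratic_eq_zero (by positivity) (by positivity) hroot
end

section
/- Let m₀, τ_κ, τ_η, α > 0 and let g, σ be real numbers with g ≠ 0. Let γ := [[0, g/m₀, −σ/m₀], [−αg/τ_κ, α/τ_κ, 0], [0, 0, α/τ_η]] and let σ̂ ∈ ℝ³ be the column vector (0, 0, α/τ_η). Set Dn := τ_η²g² + m₀α(τ_κ+τ_η). Then the symmetric 3×3 matrix J with entries J₁₁ = (σ²/(2m₀g²))·(τ_κ²g² + m₀α(τ_κ+τ_η))/Dn, J₁₂ = J₂₁ = ασ²(τ_κ+τ_η)/(2g·Dn), J₁₃ = J₃₁ = ασ(τ_κ+τ_η)/(2·Dn), J₂₂ = ασ²(τ_κ+τ_η)/(2·Dn), J₂₃ = J₃₂ = τ_η α σ g/(2·Dn), J₃₃ = α/(2τ_η) satisfies the Lyapunov equation γ J + J γ* = σ̂ σ̂*. -/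
open Matrix

/-- The explicit symmetric matrix `J` solves the Lyapunov equation
`γ J + J γᵀ = σ̂ σ̂ᵀ` for the 3×3 drift matrix `γ` of the one-dimensional
Ornstein–Uhlenbeck model, where `σ̂ = (0, 0, α/τη)`. -/
theorem explicit_lyapunov_solution
    (m₀ τκ τη α : ℝ) (hm₀ : 0 < m₀) (hτκ : 0 < τκ) (hτη : 0 < τη) (hα : 0 < α)
    (g σ : ℝ) (hg : g ≠ 0) :
    let γ : Matrix (Fin 3) (Fin 3) ℝ :=
      !![0, g / m₀, -σ / m₀; -α * g / τκ, α / τκ, 0; 0, 0, α / τη]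
    let σhat : Fin 3 → ℝ := ![0, 0, α / τη]
    let Dn : ℝ := τη ^ 2 * g ^ 2 + m₀ * α * (τκ + τη)
    let J : Matrix (Fin 3) (Fin 3) ℝ :=
      !![σ ^ 2 / (2 * m₀ * g ^ 2) * ((τκ ^ 2 * g ^ 2 + m₀ * α * (τκ + τη)) / Dn),
          α * σ ^ 2 * (τκ + τη) / (2 * g * Dn),
          α * σ * (τκ + τη) / (2 * Dn);
        α * σ ^ 2 * (τκ + τη) / (2 * g * Dn),
          α * σ ^ 2 * (τκ + τη) / (2 * Dn),
          τη * α * σ * g / (2 * Dn);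
        α * σ * (τκ + τη) / (2 * Dn),
          τη * α * σ * g / (2 * Dn),
          α / (2 * τη)]
    γ * J + J * γᵀ = Matrix.vecMulVec σhat σhat := by
  intro γ σhat Dn J
  have hDn : Dn ≠ 0 := by positivity
  have hDn_eq : Dn = τη ^ 2 * g ^ 2 + m₀ * α * (τκ + τη) := rfl
  clear_value Dn
  ext i j
  simp only [Matrix.add_apply, Matrix.mul_apply, Fin.sum_univ_three, Matrix.transpose_apply,
    Matrix.vecMulVec_apply]
  fin_cases i <;> fin_cases j <;> simp [γ, J, σhat] <;> field_simp <;> grind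
end

section
/- Let a < b be real numbers, let k_B, m₀, τ, α > 0, and let T, D : [a, b] → (0, ∞) be continuously differentiable. Set r := τ/m₀, γ(y) := k_B T(y)/D(y), define the thermophoretic drift b₁(X) := D'(X) − (2 m₀ α D(X)²/((τ k_B T(X) + 2 m₀ α D(X)) T(X))) · T'(X), and define ρ(X) := exp( −∫_a^X 2α T'(y)/((r γ(y) + 2α) T(y)) dy ). Then for every X ∈ [a, b]: (D ρ)'(X) = b₁(X) ρ(X). -/
/-- The fundamental theorem of calculus on a closed interval, with one-sided derivatives at the
endpoints. -/
theorem ContinuousOn.hasDerivWithinAt_integral_Icc {f : ℝ → ℝ} {a b x : ℝ}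
    (hf : ContinuousOn f (Set.Icc a b)) (hx : x ∈ Set.Icc a b) :
    HasDerivWithinAt (fun z => ∫ y in a..z, f y) (f x) (Set.Icc a b) x := by
  have : Fact (x ∈ Set.Icc a b) := ⟨hx⟩
  have hint : IntervalIntegrable f MeasureTheory.volume a x :=
    ContinuousOn.intervalIntegrable_of_Icc hx.1 (hf.mono (Set.Icc_subset_Icc_right hx.2))
  exact intervalIntegral.integral_hasDerivWithinAt_right hint
    (hf.stronglyMeasurableAtFilter_nhdsWithin measurableSet_Icc x) (hf x hx)

/-- The steady-state density `ρ(X) = exp(−∫_a^X 2α T'/((rγ + 2α) T))` of the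
homogenized thermophoresis dynamics satisfies the zero-flux equation `(Dρ)' = b₁ ρ` on `[a, b]`,
where `b₁` is the thermophoretic drift, `r = τ/m₀` and `γ = k_B T/D`. -/
theorem stationary_density_zero_flux
    (a b kB m₀ τ α : ℝ) (hab : a < b)
    (hkB : 0 < kB) (hm₀ : 0 < m₀) (hτ : 0 < τ) (hα : 0 < α)
    (T D : ℝ → ℝ)
    (hTpos : ∀ x ∈ Set.Icc a b, 0 < T x) (hDpos : ∀ x ∈ Set.Icc a b, 0 < D x)
    (hT : ContDiffOn ℝ 1 T (Set.Icc a b)) (hD : ContDiffOn ℝ 1 D (Set.Icc a b)) :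
    let r : ℝ := τ / m₀
    let γ : ℝ → ℝ := fun y => kB * T y / D y
    let T' : ℝ → ℝ := fun y => derivWithin T (Set.Icc a b) y
    let D' : ℝ → ℝ := fun y => derivWithin D (Set.Icc a b) y
    let b₁ : ℝ → ℝ := fun X =>
      D' X - (2 * m₀ * α * (D X) ^ 2 / ((τ * kB * T X + 2 * m₀ * α * D X) * T X)) * T' X
    let ρ : ℝ → ℝ := fun X =>
      Real.exp (-∫ y in a..X, 2 * α * T' y / ((r * γ y + 2 * α) * T y))
    ∀ X ∈ Set.Icc a b,
      derivWithin (fun z => D z * ρ z) (Set.Icc a b) X = b₁ X * ρ X := by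
  intro r γ T' D' b₁ ρ X hX
  have hr : 0 < r := div_pos hτ hm₀
  have hden : ∀ y ∈ Set.Icc a b, (r * γ y + 2 * α) * T y ≠ 0 := fun y hy => by
    have hTy := hTpos y hy
    have hγ : 0 < γ y := div_pos (mul_pos hkB hTy) (hDpos y hy)
    positivity
  have hud := uniqueDiffOn_Icc hab
  have hT' : ContinuousOn T' (Set.Icc a b) := hT.continuousOn_derivWithin hud le_rfl
  have hγ : ContinuousOn γ (Set.Icc a b) :=
    (continuousOn_const.mul hT.continuousOn).div hD.continuousOn fun y hy => (hDpos y hy).ne'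
  have hf : ContinuousOn (fun y => 2 * α * T' y / ((r * γ y + 2 * α) * T y)) (Set.Icc a b) :=
    (continuousOn_const.mul hT').div
      (((continuousOn_const.mul hγ).add continuousOn_const).mul hT.continuousOn) hden
  have hρ := (hf.hasDerivWithinAt_integral_Icc hX).neg.exp
  have hDX : HasDerivWithinAt D (D' X) (Set.Icc a b) X :=
    (hD.differentiableOn one_ne_zero X hX).hasDerivWithinAt
  refine ((hDX.mul hρ).derivWithin (hud X hX)).trans ?_
  have hTX := hTpos X hX
  have hDX := hDpos X hX
  have hcoef : D X * (2 * α * T' X / ((r * γ X + 2 * α) * T X)) =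
      2 * m₀ * α * (D X) ^ 2 / ((τ * kB * T X + 2 * m₀ * α * D X) * T X) * T' X := by
    have hrγ : r * γ X + 2 * α = (τ * kB * T X + 2 * m₀ * α * D X) / (m₀ * D X) := by
      simp only [r, γ]
      field_simp
    rw [hrγ]
    field_simp
  change D' X * ρ X + D X * (ρ X * -(2 * α * T' X / ((r * γ X + 2 * α) * T X))) = b₁ X * ρ X
  simp only [b₁]
  rw [← hcoef]
  ring
end

section
/- Let k_B, R, m₀, τ, α > 0, let T : ℝ → (0, ∞) be differentiable, and let μ : (0, ∞) → (0, ∞) be differentiable. Fix X ∈ ℝ and suppose T'(X) > 0 and μ(T(X)) − μ'(T(X)) T(X) > 0. Define b₁(X) := k_B T'(X) · ( τ/(2(α m₀ + 3πR τ μ(T(X)))) − μ'(T(X)) T(X)/(6πR μ(T(X))²) ) and the critical ratio r_c := (α/(3πR μ(T(X)))) · ( μ'(T(X)) T(X)/(μ(T(X)) − μ'(T(X)) T(X)) ). Then b₁(X) > 0 if and only if τ/m₀ > r_c. -/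
/-- Sign of the thermophoretic drift: under `T'(X) > 0` and
`μ(T(X)) − μ'(T(X)) T(X) > 0`, the drift `b₁(X)` is positive iff `τ/m₀` exceeds the
critical ratio `r_c`. -/
theorem thermophoretic_drift_sign
    (kB R m₀ τ α : ℝ) (hkB : 0 < kB) (hR : 0 < R) (hm₀ : 0 < m₀) (hτ : 0 < τ) (hα : 0 < α)
    (T : ℝ → ℝ) (hTpos : ∀ x, 0 < T x) (hT : Differentiable ℝ T)
    (μ : ℝ → ℝ) (hμpos : ∀ t, 0 < t → 0 < μ t)
    (hμ : ∀ t, 0 < t → DifferentiableAt ℝ μ t)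
    (X : ℝ) (hT' : 0 < deriv T X)
    (hcrit : 0 < μ (T X) - deriv μ (T X) * T X) :
    let b₁ : ℝ :=
      kB * deriv T X *
        (τ / (2 * (α * m₀ + 3 * Real.pi * R * τ * μ (T X))) -
          deriv μ (T X) * T X / (6 * Real.pi * R * (μ (T X)) ^ 2))
    let rc : ℝ :=
      (α / (3 * Real.pi * R * μ (T X))) *
        (deriv μ (T X) * T X / (μ (T X) - deriv μ (T X) * T X))
    (0 < b₁ ↔ rc < τ / m₀) := by
  intro b₁ rc
  have hM : 0 < μ (T X) := hμpos _ (hTpos X)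
  have hπ := Real.pi_pos
  simp only [b₁, rc]
  generalize μ (T X) = M at *
  generalize deriv μ (T X) * T X = p at *
  rw [mul_pos_iff_of_pos_left (mul_pos hkB hT'), sub_pos,
    div_lt_div_iff₀ (by positivity) (by positivity), div_mul_div_comm,
    div_lt_div_iff₀ (by positivity) hm₀]
  constructor <;> intro h <;> linarith
end

section
/- Let k_B, R, μ₀, α, m₀, τ > 0, let T : ℝ → (0, ∞) be differentiable, and set D(X) := k_B T(X)/(6πR μ₀), r := τ/m₀, and b₁(X) := D'(X) − (2 m₀ α D(X)²/((τ k_B T(X) + 2 m₀ α D(X)) T(X))) · T'(X). Then for every X ∈ ℝ: b₁(X) = (k_B T'(X)/(6πR μ₀)) · (1 − α/(α + 3πr R μ₀)); in particular, b₁(X) > 0 iff T'(X) > 0, b₁(X) = 0 iff T'(X) = 0, and b₁(X) < 0 iff T'(X) < 0. -/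
/-- For constant viscosity `μ₀`, with `D = k_B T/(6πR μ₀)`, the thermophoretic
drift is `b₁ = (k_B T'/(6πR μ₀))(1 − α/(α + 3πrRμ₀))` with `r = τ/m₀`; in particular `b₁`
has the same sign as `T'`. -/
theorem thermophoretic_drift_constant_viscosity
    (kB R μ₀ α m₀ τ : ℝ)
    (hkB : 0 < kB) (hR : 0 < R) (hμ₀ : 0 < μ₀) (hα : 0 < α) (hm₀ : 0 < m₀) (hτ : 0 < τ)
    (T : ℝ → ℝ) (hTpos : ∀ x, 0 < T x) (hT : Differentiable ℝ T) :
    let D : ℝ → ℝ := fun X => kB * T X / (6 * Real.pi * R * μ₀)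
    let r : ℝ := τ / m₀
    let b₁ : ℝ → ℝ := fun X =>
      deriv D X -
        (2 * m₀ * α * (D X) ^ 2 / ((τ * kB * T X + 2 * m₀ * α * D X) * T X)) * deriv T X
    ∀ X : ℝ,
      b₁ X =
          (kB * deriv T X / (6 * Real.pi * R * μ₀)) *
            (1 - α / (α + 3 * Real.pi * r * R * μ₀)) ∧
        (0 < b₁ X ↔ 0 < deriv T X) ∧
        (b₁ X = 0 ↔ deriv T X = 0) ∧
        (b₁ X < 0 ↔ deriv T X < 0) := by
  intro D r b₁ X
  have hπ := Real.pi_pos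
  have hTX := hTpos X
  have hr : 0 < r := div_pos hτ hm₀
  have hD : deriv D X = kB * deriv T X / (6 * Real.pi * R * μ₀) :=
    (((hT X).hasDerivAt.const_mul kB).div_const _).deriv
  have hb : b₁ X = (kB * deriv T X / (6 * Real.pi * R * μ₀)) *
      (1 - α / (α + 3 * Real.pi * r * R * μ₀)) := by
    have hdrag : 0 < m₀ * α + 3 * Real.pi * τ * R * μ₀ := by positivity
    have hratio : 2 * m₀ * α * (D X) ^ 2 / ((τ * kB * T X + 2 * m₀ * α * D X) * T X) =
        kB / (6 * Real.pi * R * μ₀) * (m₀ * α / (m₀ * α + 3 * Real.pi * τ * R * μ₀)) := by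
      have hDX : 0 < D X := by positivity
      rw [div_mul_div_comm, div_eq_div_iff (by positivity) (by positivity)]
      simp only [D]
      field_simp
      ring
    have hfrac : α / (α + 3 * Real.pi * r * R * μ₀) =
        m₀ * α / (m₀ * α + 3 * Real.pi * τ * R * μ₀) := by
      rw [div_eq_div_iff (by positivity) (by positivity)]
      simp only [r]
      field_simp
    simp only [b₁]
    rw [hD, hratio, hfrac]
    ring
  have hfactor : 0 < kB / (6 * Real.pi * R * μ₀) *
      (1 - α / (α + 3 * Real.pi * r * R * μ₀)) := by
    refine mul_pos (by positivity) (sub_pos.mpr ?_)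
    rw [div_lt_one (by positivity)]
    exact lt_add_of_pos_right _ (by positivity)
  have hsign : b₁ X = kB / (6 * Real.pi * R * μ₀) *
      (1 - α / (α + 3 * Real.pi * r * R * μ₀)) * deriv T X := by
    rw [hb]
    ring
  refine ⟨hb, ?_, ?_, ?_⟩ <;> rw [hsign]
  · exact mul_pos_iff_of_pos_left hfactor
  · exact mul_eq_zero_iff_left hfactor.ne'
  · exact smul_neg_iff_of_pos_left hfactor
end

section
/- Fix real numbers m₀, τ, k_B > 0 and D > 0, T > 0, and arbitrary real numbers D', T'. For Ω > 0 define b₂(Ω) := D' − [ (4 m₀² Ω⁶ D² + τ² (k_B T)²) · D / (4 m₀² Ω⁶ D² + 2 k_B T m₀ τ Ω⁴ (Ω² − 1) D + τ² (1 + 2Ω²) (k_B T)²) ] · (T'/T). Then lim_{Ω → ∞} b₂(Ω) = D' − [ 2 m₀ D²/(τ k_B T + 2 m₀ D) ] · (T'/T); that is, as Ω → ∞ the thermophoretic drift of the harmonic-noise model converges to the thermophoretic drift b₁ of the Ornstein–Uhlenbeck model with α = 1. -/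
open Filter

/-- As `Ω → ∞`, the thermophoretic drift `b₂(Ω)` of the harmonic-noise model
converges to the thermophoretic drift of the Ornstein–Uhlenbeck model with `α = 1`. -/
theorem harmonic_drift_limit
    (m₀ τ kB : ℝ) (hm₀ : 0 < m₀) (hτ : 0 < τ) (hkB : 0 < kB)
    (D T D' T' : ℝ) (hD : 0 < D) (hT : 0 < T) :
    let b₂ : ℝ → ℝ := fun Ω =>
      D' -
        (4 * m₀ ^ 2 * Ω ^ 6 * D ^ 2 + τ ^ 2 * (kB * T) ^ 2) * D /
            (4 * m₀ ^ 2 * Ω ^ 6 * D ^ 2 + 2 * kB * T * m₀ * τ * Ω ^ 4 * (Ω ^ 2 - 1) * D +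
              τ ^ 2 * (1 + 2 * Ω ^ 2) * (kB * T) ^ 2) *
          (T' / T)
    Tendsto b₂ atTop
      (nhds (D' - 2 * m₀ * D ^ 2 / (τ * kB * T + 2 * m₀ * D) * (T' / T))) := by
  intro b₂
  refine tendsto_const_nhds.sub (Tendsto.mul_const _ ?_)
  -- Dividing numerator and denominator by `Ω ^ 6` gives a function of `x = Ω⁻¹` continuous at `0`.
  let g : ℝ → ℝ := fun x =>
    (4 * m₀ ^ 2 * D ^ 2 + τ ^ 2 * (kB * T) ^ 2 * x ^ 6) * D /
      (4 * m₀ ^ 2 * D ^ 2 + 2 * kB * T * m₀ * τ * (1 - x ^ 2) * D +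
        τ ^ 2 * (x ^ 6 + 2 * x ^ 4) * (kB * T) ^ 2)
  have hg : ContinuousAt g 0 := by
    refine ContinuousAt.div (by fun_prop) (by fun_prop) ?_
    norm_num
    positivity
  have hg0 : g 0 = 2 * m₀ * D ^ 2 / (τ * kB * T + 2 * m₀ * D) := by
    simp only [g]
    rw [div_eq_div_iff (by norm_num; positivity) (by positivity)]
    ring
  rw [← hg0]
  refine (hg.tendsto.comp tendsto_inv_atTop_zero).congr' ?_
  filter_upwards [eventually_gt_atTop 0] with Ω hΩ
  have hΩ6 : Ω ^ 6 ≠ 0 := by positivity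
  simp only [g, Function.comp_apply]
  rw [← mul_div_mul_right _ _ hΩ6]
  congr 1 <;> field_simp
end

section
/- Let τ > 0 and let a be a real number with 0 < |a| < 2. Set ω₀ := a√(1 − a²/4) and ω₁ := a/√(1 − a²/4). Then for every t ≥ 0, the improper integral converges and (2/π) ∫₀^∞ [ (a/τ)⁴ / ( ω² (a²/τ)² + (ω² − (a/τ)²)² ) ] cos(ωt) dω = (1/τ) e^{−a² t/(2τ)} [ cos(ω₀ t/τ) + (ω₁/2) sin(ω₀ t/τ) ]. -/
open MeasureTheory FourierTransform

/-- `p² + ω²` factors over `ℂ` as `(p + iω)(p - iω)`. -/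
lemma sq_add_sq_eq_add_I_mul_mul_sub_I_mul (p : ℂ) (ω : ℝ) :
    p ^ 2 + (ω : ℂ) ^ 2 = (p + Complex.I * ω) * (p - Complex.I * ω) := by
  linear_combination (ω : ℂ) ^ 2 * Complex.I_sq

lemma sq_add_sq_ne_zero_of_re_pos {p : ℂ} (hp : 0 < p.re) (ω : ℝ) :
    p ^ 2 + (ω : ℂ) ^ 2 ≠ 0 := by
  rw [sq_add_sq_eq_add_I_mul_mul_sub_I_mul]
  refine mul_ne_zero (fun h => ?_) (fun h => ?_) <;>
  · have := congrArg Complex.re h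
    simp at this
    linarith

lemma integrable_inv_sq_add_add_sq {r : ℝ} (hr : 0 < r) (s : ℝ) :
    Integrable fun ω : ℝ => (r ^ 2 + (ω + s) ^ 2)⁻¹ := by
  have h := ((integrable_inv_one_add_sq.comp_div hr.ne').comp_add_right s).const_mul (r ^ 2)⁻¹
  refine h.congr (.of_forall fun ω => ?_)
  have : 0 < r ^ 2 + (ω + s) ^ 2 := by positivity
  simp only
  field_simp

lemma integrable_inv_sq_add_sq {p : ℂ} (hp : 0 < p.re) :
    Integrable fun ω : ℝ => (p ^ 2 + (ω : ℂ) ^ 2)⁻¹ := by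
  refine ((integrable_inv_sq_add_add_sq hp p.im).add
    (integrable_inv_sq_add_add_sq hp (-p.im))).mono' ?_ (.of_forall fun ω => ?_)
  · refine Continuous.aestronglyMeasurable (Continuous.inv₀ (by fun_prop)
      (sq_add_sq_ne_zero_of_re_pos hp))
  · have h₁ : ‖p + Complex.I * ω‖ ^ 2 = p.re ^ 2 + (ω + p.im) ^ 2 := by
      rw [Complex.sq_norm, Complex.normSq_apply]; simp; ring
    have h₂ : ‖p - Complex.I * ω‖ ^ 2 = p.re ^ 2 + (ω + -p.im) ^ 2 := by
      rw [Complex.sq_norm, Complex.normSq_apply]; simp; ring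
    simp only [Pi.add_apply]
    rw [← h₁, ← h₂, sq_add_sq_eq_add_I_mul_mul_sub_I_mul, norm_inv, norm_mul, mul_inv,
      ← inv_pow, ← inv_pow]
    nlinarith [sq_nonneg (‖p + Complex.I * ω‖⁻¹ - ‖p - Complex.I * ω‖⁻¹),
      sq_nonneg (‖p + Complex.I * ω‖⁻¹), sq_nonneg (‖p - Complex.I * ω‖⁻¹)]

lemma exp_mul_exp_neg_mul_abs_eqOn_Iic (p b : ℂ) :
    Set.EqOn (fun v : ℝ => Complex.exp (b * v) * Complex.exp (-p * |v|))
      (fun v : ℝ => Complex.exp ((b + p) * v)) (Set.Iic 0) := by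
  intro v hv
  simp only [abs_of_nonpos (Set.mem_Iic.mp hv)]
  rw [← Complex.exp_add]
  push_cast
  ring_nf

lemma exp_mul_exp_neg_mul_abs_eqOn_Ioi (p b : ℂ) :
    Set.EqOn (fun v : ℝ => Complex.exp (b * v) * Complex.exp (-p * |v|))
      (fun v : ℝ => Complex.exp ((b - p) * v)) (Set.Ioi 0) := by
  intro v hv
  simp only [abs_of_pos (Set.mem_Ioi.mp hv)]
  rw [← Complex.exp_add]
  ring_nf

lemma integrable_exp_mul_exp_neg_mul_abs {p b : ℂ} (h₁ : 0 < (b + p).re) (h₂ : (b - p).re < 0) :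
    Integrable fun v : ℝ => Complex.exp (b * v) * Complex.exp (-p * |v|) := by
  rw [← integrableOn_univ, ← Set.Iic_union_Ioi (a := (0 : ℝ))]
  exact ((integrableOn_exp_mul_complex_Iic h₁ 0).congr_fun
      (exp_mul_exp_neg_mul_abs_eqOn_Iic p b).symm measurableSet_Iic).union
    ((integrableOn_exp_mul_complex_Ioi h₂ 0).congr_fun
      (exp_mul_exp_neg_mul_abs_eqOn_Ioi p b).symm measurableSet_Ioi)

lemma integral_exp_mul_exp_neg_mul_abs {p b : ℂ} (h₁ : 0 < (b + p).re) (h₂ : (b - p).re < 0) :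
    ∫ v : ℝ, Complex.exp (b * v) * Complex.exp (-p * |v|) = 1 / (b + p) - 1 / (b - p) := by
  have hint := integrable_exp_mul_exp_neg_mul_abs h₁ h₂
  rw [← intervalIntegral.integral_Iic_add_Ioi (b := 0) hint.integrableOn hint.integrableOn,
    setIntegral_congr_fun measurableSet_Iic (exp_mul_exp_neg_mul_abs_eqOn_Iic p b),
    setIntegral_congr_fun measurableSet_Ioi (exp_mul_exp_neg_mul_abs_eqOn_Ioi p b),
    integral_exp_mul_complex_Iic h₁, integral_exp_mul_complex_Ioi h₂]
  simp
  ring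

lemma fourier_exp_neg_mul_abs {p : ℂ} (hp : 0 < p.re) :
    𝓕 (fun v : ℝ => Complex.exp (-p * |v|)) =
      fun ξ : ℝ => 2 * p * (p ^ 2 + ((2 * Real.pi * ξ : ℝ) : ℂ) ^ 2)⁻¹ := by
  ext ξ
  have hne := sq_add_sq_ne_zero_of_re_pos hp (2 * Real.pi * ξ)
  rw [Real.fourier_real_eq_integral_exp_smul]
  have h := integral_exp_mul_exp_neg_mul_abs (p := p)
    (b := -(Complex.I * ((2 * Real.pi * ξ : ℝ) : ℂ))) (by simpa using hp) (by simpa using hp)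
  convert h using 1
  · refine integral_congr_ae (.of_forall fun v => ?_)
    simp only [smul_eq_mul]
    congr 2
    push_cast
    ring
  · rw [sq_add_sq_eq_add_I_mul_mul_sub_I_mul] at hne ⊢
    have h₁ := left_ne_zero_of_mul hne
    have h₂ := right_ne_zero_of_mul hne
    generalize Complex.I * ((2 * Real.pi * ξ : ℝ) : ℂ) = z at *
    have h₃ : -z + p ≠ 0 := by rwa [neg_add_eq_sub]
    have h₄ : -z - p ≠ 0 := by rw [← neg_add', add_comm]; exact neg_ne_zero.mpr h₁
    rw [← div_eq_mul_inv, div_sub_div _ _ h₃ h₄, div_eq_div_iff hne (mul_ne_zero h₃ h₄)]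
    ring

lemma integral_exp_mul_inv_sq_add_sq {p : ℂ} (hp : 0 < p.re) (t : ℝ) :
    ∫ ω : ℝ, Complex.exp ((ω * t : ℝ) * Complex.I) * (p * (p ^ 2 + (ω : ℂ) ^ 2)⁻¹) =
      Real.pi * Complex.exp (-p * |t|) := by
  have hint : Integrable fun v : ℝ => Complex.exp (-p * |v|) := by
    simpa using integrable_exp_mul_exp_neg_mul_abs (p := p) (b := 0) (by simpa) (by simpa)
  have hF : Integrable (𝓕 fun v : ℝ => Complex.exp (-p * |v|)) := by
    rw [fourier_exp_neg_mul_abs hp]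
    exact ((integrable_inv_sq_add_sq hp).comp_mul_left' Real.two_pi_pos.ne').const_mul _
  have h := congrFun (Continuous.fourierInv_fourier_eq (by fun_prop) hint hF) t
  rw [fourier_exp_neg_mul_abs hp, Real.fourierInv_eq'] at h
  have hs := Measure.integral_comp_mul_left (fun ω : ℝ =>
    Complex.exp ((ω * t : ℝ) * Complex.I) * (2 * p * (p ^ 2 + (ω : ℂ) ^ 2)⁻¹)) (2 * Real.pi)
  have e : (fun v : ℝ => Complex.exp (((2 * Real.pi * inner ℝ v t : ℝ) : ℂ) * Complex.I) •
      (2 * p * (p ^ 2 + ((2 * Real.pi * v : ℝ) : ℂ) ^ 2)⁻¹)) = fun v : ℝ =>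
      Complex.exp (((2 * Real.pi * v) * t : ℝ) * Complex.I) *
        (2 * p * (p ^ 2 + ((2 * Real.pi * v : ℝ) : ℂ) ^ 2)⁻¹) := by
    ext v
    simp only [smul_eq_mul, RCLike.inner_apply, conj_trivial, mul_comm t, mul_assoc]
  rw [e, hs, abs_of_pos (by positivity), Complex.real_smul] at h
  have hpi : (Real.pi : ℂ) ≠ 0 := by exact_mod_cast Real.pi_ne_zero
  simp_rw [mul_assoc (2 : ℂ) p, mul_left_comm _ (2 : ℂ)] at h
  rw [integral_const_mul] at h
  rw [← h, ← mul_assoc, ← mul_assoc]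
  push_cast
  rw [show (Real.pi : ℂ) * (2 * (Real.pi : ℂ))⁻¹ * 2 = 1 by field_simp, one_mul]

lemma integrable_cos_mul_inv_sq_add_sq {p : ℂ} (hp : 0 < p.re) (t : ℝ) :
    Integrable fun ω : ℝ => p / (p ^ 2 + (ω : ℂ) ^ 2) * (Real.cos (ω * t) : ℂ) := by
  refine ((integrable_inv_sq_add_sq hp).const_mul p).mul_bdd (c := 1)
    (Continuous.aestronglyMeasurable (by fun_prop)) (.of_forall fun ω => ?_)
  rw [Complex.norm_real]
  exact Real.abs_cos_le_one _

/-- The Laplace cosine integral `∫₀^∞ p cos(ωt) / (p² + ω²) dω = (π/2) e^{-p|t|}`, for complex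
`p` with positive real part. -/
lemma integral_Ioi_cos_mul_inv_sq_add_sq {p : ℂ} (hp : 0 < p.re) (t : ℝ) :
    ∫ ω in Set.Ioi (0 : ℝ), p / (p ^ 2 + (ω : ℂ) ^ 2) * (Real.cos (ω * t) : ℂ) =
      Real.pi / 2 * Complex.exp (-p * |t|) := by
  set h : ℝ → ℂ := fun ω =>
    Complex.exp ((ω * t : ℝ) * Complex.I) * (p * (p ^ 2 + (ω : ℂ) ^ 2)⁻¹) with hh
  have hi : Integrable h := by
    refine ((integrable_inv_sq_add_sq hp).const_mul p).bdd_mul (c := 1)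
      (Continuous.aestronglyMeasurable (by fun_prop)) (.of_forall fun ω => ?_)
    rw [Complex.norm_exp_ofReal_mul_I]
  have hsplit := intervalIntegral.integral_Iic_add_Ioi (b := 0) hi.integrableOn hi.integrableOn
  rw [integral_exp_mul_inv_sq_add_sq hp] at hsplit
  have hneg := integral_comp_neg_Ioi 0 h
  rw [neg_zero] at hneg
  rw [← hneg, ← integral_add hi.comp_neg.integrableOn hi.integrableOn] at hsplit
  have e : ∀ ω : ℝ, h (-ω) + h ω =
      2 * (p / (p ^ 2 + (ω : ℂ) ^ 2) * (Real.cos (ω * t) : ℂ)) := by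
    intro ω
    simp only [hh, Complex.ofReal_cos, Complex.cos]
    push_cast
    ring_nf
  simp_rw [e] at hsplit
  rw [integral_const_mul] at hsplit
  linear_combination hsplit / 2

/-- Partial fractions of the bath spectrum, with poles at `ω = ± i p`, `± i p̄` for
`p = γ/2 - i w`. -/
lemma bath_spectrum_partial_fractions {γ w : ℝ} (hw : w ≠ 0) (ω : ℝ) :
    (γ * (γ ^ 2 / 4 + w ^ 2) /
        (ω ^ 2 * γ ^ 2 + (ω ^ 2 - (γ ^ 2 / 4 + w ^ 2)) ^ 2) : ℝ) =
      (((γ / 2 - Complex.I * w) / ((γ / 2 - Complex.I * w) ^ 2 + (ω : ℂ) ^ 2)) *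
        (1 - Complex.I * (γ / (2 * w)))).re := by
  set p : ℂ := γ / 2 - Complex.I * w with hp
  have hre : (p ^ 2 + (ω : ℂ) ^ 2).re = γ ^ 2 / 4 - w ^ 2 + ω ^ 2 := by
    simp [hp, pow_two]; ring
  have him : (p ^ 2 + (ω : ℂ) ^ 2).im = -(γ * w) := by
    simp [hp, pow_two]; ring
  have hD : Complex.normSq (p ^ 2 + (ω : ℂ) ^ 2) =
      ω ^ 2 * γ ^ 2 + (ω ^ 2 - (γ ^ 2 / 4 + w ^ 2)) ^ 2 := by
    rw [Complex.normSq_apply, hre, him]; ring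
  have hnum : p * (1 - Complex.I * (γ / (2 * w))) =
      ((-(w + γ ^ 2 / (4 * w)) : ℝ) : ℂ) * Complex.I := by
    have : (w : ℂ) ≠ 0 := by exact_mod_cast hw
    rw [hp]
    push_cast
    field_simp
    linear_combination (8 * γ * w : ℂ) * Complex.I_sq
  have hc : γ * (γ ^ 2 / 4 + w ^ 2) = -(w + γ ^ 2 / (4 * w)) * -(γ * w) := by
    field_simp
    ring
  rw [div_mul_eq_mul_div, hnum, Complex.div_re, hD, hre, him, hc, Complex.re_ofReal_mul,
    Complex.im_ofReal_mul, Complex.I_re, Complex.I_im]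
  ring

lemma bath_spectrum_mul_cos_eq_re {γ w : ℝ} (hw : w ≠ 0) (t ω : ℝ) :
    γ * (γ ^ 2 / 4 + w ^ 2) /
        (ω ^ 2 * γ ^ 2 + (ω ^ 2 - (γ ^ 2 / 4 + w ^ 2)) ^ 2) * Real.cos (ω * t) =
      RCLike.re (((γ / 2 - Complex.I * w) / ((γ / 2 - Complex.I * w) ^ 2 + (ω : ℂ) ^ 2)) *
        (Real.cos (ω * t) : ℂ) * (1 - Complex.I * (γ / (2 * w)))) := by
  rw [bath_spectrum_partial_fractions hw, mul_right_comm, RCLike.re_to_complex,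
    Complex.re_mul_ofReal]

lemma integrable_bath_spectrum_mul_cos {γ w : ℝ} (hγ : 0 < γ) (hw : w ≠ 0) (t : ℝ) :
    Integrable fun ω : ℝ => γ * (γ ^ 2 / 4 + w ^ 2) /
      (ω ^ 2 * γ ^ 2 + (ω ^ 2 - (γ ^ 2 / 4 + w ^ 2)) ^ 2) * Real.cos (ω * t) := by
  simp_rw [bath_spectrum_mul_cos_eq_re hw]
  exact ((integrable_cos_mul_inv_sq_add_sq (by simpa using hγ) t).mul_const _).re

lemma integral_Ioi_bath_spectrum_mul_cos {γ w : ℝ} (hγ : 0 < γ) (hw : w ≠ 0) (t : ℝ)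
    (ht : 0 ≤ t) :
    ∫ ω in Set.Ioi (0 : ℝ), γ * (γ ^ 2 / 4 + w ^ 2) /
        (ω ^ 2 * γ ^ 2 + (ω ^ 2 - (γ ^ 2 / 4 + w ^ 2)) ^ 2) * Real.cos (ω * t) =
      Real.pi / 2 * Real.exp (-(γ * t) / 2) *
        (Real.cos (w * t) + γ / (2 * w) * Real.sin (w * t)) := by
  have hp : 0 < ((γ : ℂ) / 2 - Complex.I * w).re := by simpa using hγ
  simp_rw [bath_spectrum_mul_cos_eq_re hw]
  rw [integral_re ((integrable_cos_mul_inv_sq_add_sq hp t).mul_const _).integrableOn,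
    integral_mul_const, integral_Ioi_cos_mul_inv_sq_add_sq hp, abs_of_nonneg ht]
  have e : Complex.exp (-((γ : ℂ) / 2 - Complex.I * w) * t) =
      (Real.exp (-(γ * t) / 2) : ℂ) *
        ((Real.cos (w * t) : ℂ) + (Real.sin (w * t) : ℂ) * Complex.I) := by
    push_cast
    rw [← Complex.exp_mul_I, ← Complex.exp_add]
    ring_nf
  have e' : (Real.pi : ℂ) / 2 * Complex.exp (-((γ : ℂ) / 2 - Complex.I * w) * t) *
      (1 - Complex.I * (γ / (2 * w))) =
      ((Real.pi / 2 * Real.exp (-(γ * t) / 2) *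
        (Real.cos (w * t) + γ / (2 * w) * Real.sin (w * t)) : ℝ) : ℂ) +
      ((Real.pi / 2 * Real.exp (-(γ * t) / 2) *
        (Real.sin (w * t) - γ / (2 * w) * Real.cos (w * t)) : ℝ) : ℂ) * Complex.I := by
    rw [e]
    generalize Real.exp (-(γ * t) / 2) = x, Real.cos (w * t) = c, Real.sin (w * t) = s
    push_cast
    linear_combination (-(Real.pi : ℂ) / 2 * x * s * (γ / (2 * w))) * Complex.I_sq
  rw [e', RCLike.re_to_complex]
  simp only [Complex.add_re, Complex.ofReal_re, Complex.re_ofReal_mul, Complex.I_re, mul_zero,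
    add_zero]

/-- The Debye-type bath spectral integral reproduces the harmonic-noise memory
kernel: for `0 < |a| < 2`, `τ > 0` and `t ≥ 0`,
`(2/π) ∫₀^∞ (a/τ)⁴/(ω²(a²/τ)² + (ω² − (a/τ)²)²) cos(ωt) dω
  = (1/τ) e^{−a²t/(2τ)} (cos(ω₀ t/τ) + (ω₁/2) sin(ω₀ t/τ))`,
where `ω₀ = a√(1 − a²/4)` and `ω₁ = a/√(1 − a²/4)`. -/
theorem harmonic_memory_kernel_integral
    (τ a : ℝ) (hτ : 0 < τ) (ha0 : 0 < |a|) (ha2 : |a| < 2) :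
    let ω₀ : ℝ := a * Real.sqrt (1 - a ^ 2 / 4)
    let ω₁ : ℝ := a / Real.sqrt (1 - a ^ 2 / 4)
    ∀ t : ℝ, 0 ≤ t →
      IntegrableOn
        (fun ω : ℝ =>
          (a / τ) ^ 4 / (ω ^ 2 * (a ^ 2 / τ) ^ 2 + (ω ^ 2 - (a / τ) ^ 2) ^ 2) *
            Real.cos (ω * t))
        (Set.Ioi (0 : ℝ)) ∧
      (2 / Real.pi) *
          ∫ ω in Set.Ioi (0 : ℝ),
            (a / τ) ^ 4 / (ω ^ 2 * (a ^ 2 / τ) ^ 2 + (ω ^ 2 - (a / τ) ^ 2) ^ 2) *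
              Real.cos (ω * t) =
        (1 / τ) * Real.exp (-(a ^ 2 * t) / (2 * τ)) *
          (Real.cos (ω₀ * t / τ) + ω₁ / 2 * Real.sin (ω₀ * t / τ)) := by
  intro ω₀ ω₁ t ht
  have ha : a ≠ 0 := abs_pos.mp ha0
  have hpos : 0 < 1 - a ^ 2 / 4 := by
    nlinarith [sq_abs a, abs_nonneg a]
  have hr := Real.sqrt_pos.mpr hpos
  have hr2 := Real.sq_sqrt hpos.le
  simp only [ω₀, ω₁]
  set r := Real.sqrt (1 - a ^ 2 / 4)
  have hγ : 0 < a ^ 2 / τ := by positivity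
  have hw : a * r / τ ≠ 0 := by positivity
  have hΩ : (a ^ 2 / τ) ^ 2 / 4 + (a * r / τ) ^ 2 = (a / τ) ^ 2 := by
    field_simp
    rw [hr2]
    ring
  have e : ∀ ω : ℝ,
      (a / τ) ^ 4 / (ω ^ 2 * (a ^ 2 / τ) ^ 2 + (ω ^ 2 - (a / τ) ^ 2) ^ 2) * Real.cos (ω * t) =
      (1 / τ) * (a ^ 2 / τ * ((a ^ 2 / τ) ^ 2 / 4 + (a * r / τ) ^ 2) /
        (ω ^ 2 * (a ^ 2 / τ) ^ 2 +
          (ω ^ 2 - ((a ^ 2 / τ) ^ 2 / 4 + (a * r / τ) ^ 2)) ^ 2) * Real.cos (ω * t)) := by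
    intro ω
    rw [hΩ, show (a / τ) ^ 4 = 1 / τ * (a ^ 2 / τ * (a / τ) ^ 2) by field_simp]
    ring
  simp_rw [e]
  refine ⟨((integrable_bath_spectrum_mul_cos hγ hw t).const_mul _).integrableOn, ?_⟩
  rw [integral_const_mul, integral_Ioi_bath_spectrum_mul_cos hγ hw t ht,
    show -(a ^ 2 / τ * t) / 2 = -(a ^ 2 * t) / (2 * τ) by field_simp,
    show a * r / τ * t = a * r * t / τ by ring,
    show a ^ 2 / τ / (2 * (a * r / τ)) = a / r / 2 by field_simp]
  have := Real.pi_ne_zero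
  field_simp
end
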